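/- Assume that for every π ∈ (0,1), every m ≤ n in ℕ, and every concave function f : [0,1] → [0,∞), one has (T_m f)(π) ≤ (T_n f)(π) (i.e., the law of Π_{m+1} given Π_m = π dominates the law of Π_{n+1} given Π_n = π in convex order). Then the value function V(n,π) is nondecreasing in n: V(m,π) ≤ V(n,π) for all m ≤ n and all π ∈ (0,1). -/

import Mathlib

open MeasureTheory Real Set Filter

/-- The natural parameter domain of the exponential family generated by `ν`. -/
def expDom (ν : Measure ℝ) : Set ℝ :=
  {u : ℝ | Integrable (fun x => Real.exp (u * x)) ν}

/-- The cumulant generating function `B(u) = log ∫ e^{u x} dν(x)`. -/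
noncomputable def cgf (ν : Measure ℝ) (u : ℝ) : ℝ :=
  Real.log (∫ x, Real.exp (u * x) ∂ν)

/-- The (topological) support of a measure: points all of whose neighbourhoods
have nonzero measure. -/
def msupport (μ : MeasureTheory.Measure ℝ) : Set ℝ :=
  {x : ℝ | ∀ U ∈ nhds x, μ U ≠ 0}

/-- The normalizing constant `Z(n,y) = ∫ e^{uy - nB(u)} dμ(u)`. -/
noncomputable def Z (ν μ : Measure ℝ) (n : ℕ) (y : ℝ) : ℝ :=
  ∫ u, Real.exp (u * y - (n : ℝ) * cgf ν u) ∂μ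

/-- The posterior probability `q(n,y) = P(Θ > θ₀ | Y_n = y)`. -/
noncomputable def q (ν μ : Measure ℝ) (θ₀ : ℝ) (n : ℕ) (y : ℝ) : ℝ :=
  (∫ u in Set.Ioi θ₀, Real.exp (u * y - (n : ℝ) * cgf ν u) ∂μ) / Z ν μ n y

/-- The posterior distribution `μ_{n,y}(du) = e^{uy - nB(u)} μ(du) / Z(n,y)`. -/
noncomputable def post (ν μ : Measure ℝ) (n : ℕ) (y : ℝ) : Measure ℝ :=
  (ENNReal.ofReal (Z ν μ n y))⁻¹ •
    μ.withDensity (fun u => ENNReal.ofReal (Real.exp (u * y - (n : ℝ) * cgf ν u)))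

/-- The one-step transition operator: `(T_n f)(p) = E_{n,p}[f(Π_{n+1})]`, where
`Y n p` is the point on the `p`-level curve at time `n`. -/
noncomputable def T (ν μ : Measure ℝ) (θ₀ : ℝ) (Y : ℕ → ℝ → ℝ) (n : ℕ)
    (f : ℝ → ℝ) (p : ℝ) : ℝ :=
  ∫ x, f (q ν μ θ₀ (n + 1) (Y n p + x)) *
      (Z ν μ (n + 1) (Y n p + x) / Z ν μ n (Y n p)) ∂ν

/-- The finite-horizon value functions `W k n p`. -/
noncomputable def W (ν μ : Measure ℝ) (θ₀ : ℝ) (Y : ℕ → ℝ → ℝ) (c : ℝ) :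
    ℕ → ℕ → ℝ → ℝ
  | 0, _, p => min p (1 - p)
  | k + 1, n, p =>
      min (min p (1 - p)) (c + T ν μ θ₀ Y n (W ν μ θ₀ Y c k (n + 1)) p)

/-- The value function `V(n,p) = lim_k W_k(n,p) = ⨅ k, W_k(n,p)`. -/
noncomputable def Vfun (ν μ : Measure ℝ) (θ₀ : ℝ) (Y : ℕ → ℝ → ℝ) (c : ℝ)
    (n : ℕ) (p : ℝ) : ℝ :=
  ⨅ k : ℕ, W ν μ θ₀ Y c k n p



/-- The unnormalised posterior density. -/
noncomputable def dens (ν : Measure ℝ) (n : ℕ) (y u : ℝ) : ℝ :=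
  Real.exp (u * y - (n : ℝ) * cgf ν u)

/-- The mean of `α` under the member of the exponential family with parameter `u`. -/
noncomputable def kmean (ν : Measure ℝ) (α : ℝ → ℝ) (u : ℝ) : ℝ :=
  ∫ x, α x * Real.exp (u * x - cgf ν u) ∂ν

lemma cross_lemma {ρ : Measure ℝ} {D k : ℝ → ℝ} {N : Set ℝ} (hN : ∀ᵐ u ∂ρ, u ∈ N)
    (hD : Integrable D ρ) (hkD : Integrable (fun u => k u * D u) ρ)
    (hk : ∀ u ∈ N, 0 ≤ k u ∧ k u ≤ 1)
    (hmono : ∀ u ∈ N, ∀ v ∈ N, 0 < D u → D v ≤ 0 → k u ≤ k v)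
    (hI : ∫ u, D u ∂ρ ≤ 0) : ∫ u, k u * D u ∂ρ ≤ 0 := by
  set P : Set ℝ := k '' {u | u ∈ N ∧ 0 < D u} with hP
  have hbdd : BddAbove P := ⟨1, by rintro _ ⟨u, hu, rfl⟩; exact (hk u hu.1).2⟩
  have hκ0 : 0 ≤ sSup P := Real.sSup_nonneg (by rintro _ ⟨u, hu, rfl⟩; exact (hk u hu.1).1)
  have h1 : ∫ u, k u * D u ∂ρ ≤ ∫ u, sSup P * D u ∂ρ := by
    refine integral_mono_ae hkD (hD.const_mul _) ?_
    filter_upwards [hN] with u hu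
    by_cases h : 0 < D u
    · exact mul_le_mul_of_nonneg_right (le_csSup hbdd ⟨u, ⟨hu, h⟩, rfl⟩) h.le
    · push Not at h
      refine mul_le_mul_of_nonpos_right ?_ h
      refine Real.sSup_le ?_ (hk u hu).1
      rintro _ ⟨v, hv, rfl⟩
      exact hmono v hv.1 u hu hv.2 h
  rw [integral_const_mul] at h1
  nlinarith

lemma support_line {f : ℝ → ℝ} (hf : ConcaveOn ℝ (Icc 0 1) f)
    (hf0 : ∀ x ∈ Icc (0 : ℝ) 1, 0 ≤ f x) (hf1 : ∀ x ∈ Icc (0 : ℝ) 1, f x ≤ min x (1 - x))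
    (r : ℝ) (hr : r ∈ Ioo (0 : ℝ) 1) :
    ∃ A B : ℝ, 0 ≤ A ∧ A ≤ 1 ∧ 0 ≤ B ∧ B ≤ 1 ∧ f r = A * r + B * (1 - r) ∧
      ∀ p ∈ Icc (0 : ℝ) 1, f p ≤ A * p + B * (1 - p) := by
  obtain ⟨hr0, hr1⟩ := hr
  have hrI : r ∈ Icc (0 : ℝ) 1 := ⟨hr0.le, hr1.le⟩
  set P : Set ℝ := (fun p => (f p - f r) / (p - r)) '' Ioc r 1 with hP
  have hsl : ∀ p ∈ Ico 0 r, ∀ p' ∈ Ioc r 1,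
      (f p' - f r) / (p' - r) ≤ (f r - f p) / (r - p) := by
    intro p hp p' hp'
    exact hf.slope_anti_adjacent (x := p) (y := r) (z := p') ⟨hp.1, hp.2.le.trans hr1.le⟩
      ⟨hr0.le.trans hp'.1.le, hp'.2⟩ hp.2 hp'.1
  have hbdd : BddAbove P := ⟨(f r - f 0) / (r - 0), by
    rintro _ ⟨p', hp', rfl⟩; exact hsl 0 ⟨le_rfl, hr0⟩ p' hp'⟩
  have hne : P.Nonempty := ⟨_, 1, ⟨hr1, le_rfl⟩, rfl⟩
  have hf00 : f 0 = 0 := le_antisymm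
    (by simpa using hf1 0 ⟨le_rfl, zero_le_one⟩) (hf0 0 ⟨le_rfl, zero_le_one⟩)
  have hf11 : f 1 = 0 := le_antisymm
    (by simpa using hf1 1 ⟨zero_le_one, le_rfl⟩) (hf0 1 ⟨zero_le_one, le_rfl⟩)
  have hfr := hf1 r hrI
  have hfr1 : f r ≤ r := hfr.trans (min_le_left _ _)
  have hfr2 : f r ≤ 1 - r := hfr.trans (min_le_right _ _)
  set s := sSup P
  have hline : ∀ p ∈ Icc (0 : ℝ) 1, f p ≤ f r + s * (p - r) := by
    intro p hp
    rcases lt_trichotomy p r with h | h | h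
    · have : s ≤ (f r - f p) / (r - p) := csSup_le hne (by
        rintro _ ⟨p', hp', rfl⟩; exact hsl p ⟨hp.1, h⟩ p' hp')
      rw [le_div_iff₀ (by linarith)] at this
      linarith
    · subst h; simp
    · have : (f p - f r) / (p - r) ≤ s := le_csSup hbdd ⟨p, ⟨h, hp.2⟩, rfl⟩
      rw [div_le_iff₀ (by linarith)] at this
      linarith
  have e0 := hline 0 ⟨le_rfl, zero_le_one⟩
  have e1 := hline 1 ⟨zero_le_one, le_rfl⟩
  have s1 : s ≤ 1 := by
    by_contra h; push Not at h; nlinarith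
  have s2 : -1 ≤ s := by
    by_contra h; push Not at h; nlinarith
  refine ⟨f r + s * (1 - r), f r - s * r, by linarith, by nlinarith, by linarith, by nlinarith,
    by ring, fun p hp => ?_⟩
  have := hline p hp
  linarith [this]

lemma measurable_cgf (ν : Measure ℝ) [SigmaFinite ν] : Measurable (cgf ν) := by
  unfold cgf
  refine Real.measurable_log.comp ?_
  have : StronglyMeasurable (Function.uncurry fun u x : ℝ => Real.exp (u * x)) := by
    apply Measurable.stronglyMeasurable
    unfold Function.uncurry
    fun_prop
  exact (this.integral_prod_right (ν := ν)).measurable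

lemma measurable_dens (ν : Measure ℝ) [SigmaFinite ν] (n : ℕ) (y : ℝ) :
    Measurable (dens ν n y) := by
  have := measurable_cgf ν
  unfold dens
  fun_prop

lemma dens_pos (ν : Measure ℝ) (n : ℕ) (y u : ℝ) : 0 < dens ν n y u := Real.exp_pos _

lemma dens_succ (ν : Measure ℝ) (n : ℕ) (y x u : ℝ) :
    dens ν (n + 1) (y + x) u = dens ν n y u * Real.exp (u * x - cgf ν u) := by
  unfold dens
  rw [← Real.exp_add]
  congr 1
  push_cast
  ring

lemma ae_expDom (ν μ : Measure ℝ) (hsupp : msupport μ ⊆ interior (expDom ν)) :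
    ∀ᵐ u ∂μ, u ∈ expDom ν := by
  have h : μ.support ∈ ae μ := Measure.support_mem_ae
  filter_upwards [h] with u hu
  refine interior_subset (hsupp ?_)
  rw [Measure.mem_support_iff_forall] at hu
  exact fun U hU => (hu U hU).ne'

lemma integrable_dens {ν μ : Measure ℝ} [SigmaFinite ν]
    (hint : ∀ (n : ℕ) (y : ℝ),
      Integrable (fun u => (1 + |u|) * Real.exp (u * y - (n : ℝ) * cgf ν u)) μ)
    (n : ℕ) (y : ℝ) : Integrable (dens ν n y) μ := by
  refine (hint n y).mono' (measurable_dens ν n y).aestronglyMeasurable (ae_of_all _ fun u => ?_)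
  rw [Real.norm_eq_abs, abs_of_pos (dens_pos ν n y u)]
  have := dens_pos ν n y u
  change dens ν n y u ≤ (1 + |u|) * dens ν n y u
  nlinarith [abs_nonneg u]

lemma integrable_pu {ν : Measure ℝ} {u : ℝ} (hu : u ∈ expDom ν) :
    Integrable (fun x => Real.exp (u * x - cgf ν u)) ν := by
  have : (fun x => Real.exp (u * x - cgf ν u)) =
      fun x => Real.exp (u * x) * Real.exp (-cgf ν u) := by
    funext x; rw [← Real.exp_add]; congr 1
  rw [this]
  exact Integrable.mul_const hu _

lemma integral_pu {ν : Measure ℝ} (hν : ν ≠ 0) {u : ℝ} (hu : u ∈ expDom ν) :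
    ∫ x, Real.exp (u * x - cgf ν u) ∂ν = 1 := by
  have : (fun x => Real.exp (u * x - cgf ν u)) =
      fun x => Real.exp (u * x) * Real.exp (-cgf ν u) := by
    funext x; rw [← Real.exp_add]; congr 1
  rw [this, integral_mul_const]
  have hpos : 0 < ∫ x, Real.exp (u * x) ∂ν := by
    have : NeZero ν := ⟨hν⟩
    exact integral_exp_pos hu
  unfold cgf
  rw [Real.exp_neg, Real.exp_log hpos, mul_inv_cancel₀ hpos.ne']

lemma integral_pu_le {ν : Measure ℝ} {u : ℝ} (hu : u ∈ expDom ν) :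
    ∫ x, Real.exp (u * x - cgf ν u) ∂ν ≤ 1 := by
  by_cases hν : ν = 0
  · subst hν; simp
  · exact (integral_pu hν hu).le

lemma integrable_mul_pu {ν : Measure ℝ} {u : ℝ} (hu : u ∈ expDom ν) {α : ℝ → ℝ}
    (hα : Measurable α) (hα01 : ∀ x, 0 ≤ α x ∧ α x ≤ 1) :
    Integrable (fun x => α x * Real.exp (u * x - cgf ν u)) ν := by
  refine (integrable_pu hu).mono' (by fun_prop) (ae_of_all _ fun x => ?_)
  have := Real.exp_pos (u * x - cgf ν u)
  rw [Real.norm_eq_abs, abs_of_nonneg (mul_nonneg (hα01 x).1 this.le)]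
  nlinarith [(hα01 x).2]

lemma kmean_mem {ν : Measure ℝ} {u : ℝ} (hu : u ∈ expDom ν) {α : ℝ → ℝ}
    (hα : Measurable α) (hα01 : ∀ x, 0 ≤ α x ∧ α x ≤ 1) :
    0 ≤ kmean ν α u ∧ kmean ν α u ≤ 1 := by
  refine ⟨integral_nonneg fun x => mul_nonneg (hα01 x).1 (Real.exp_pos _).le, ?_⟩
  refine le_trans (integral_mono (integrable_mul_pu hu hα hα01) (integrable_pu hu) fun x => ?_)
    (integral_pu_le hu)
  have := Real.exp_pos (u * x - cgf ν u)
  change α x * Real.exp (u * x - cgf ν u) ≤ Real.exp (u * x - cgf ν u)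
  nlinarith [(hα01 x).2]

lemma kmean_compare {ν : Measure ℝ} {u v : ℝ} (hu : u ∈ expDom ν) (hv : v ∈ expDom ν)
    {α : ℝ → ℝ} (hα : Measurable α) (hα01 : ∀ x, 0 ≤ α x ∧ α x ≤ 1)
    (h : ∀ x x', 0 < (v - u) * (x - x') → α x ≤ α x') :
    kmean ν α v ≤ kmean ν α u := by
  by_cases hν : ν = 0
  · subst hν; simp [kmean]
  have key := cross_lemma (ρ := ν) (N := univ) (k := α)
    (D := fun x => Real.exp (v * x - cgf ν v) - Real.exp (u * x - cgf ν u))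
    (by simp) ((integrable_pu hv).sub (integrable_pu hu))
    (by
      have := (integrable_mul_pu hv hα hα01).sub (integrable_mul_pu hu hα hα01)
      refine this.congr (ae_of_all _ fun x => ?_)
      simp only [Pi.sub_apply]; ring)
    (fun x _ => hα01 x)
    (by
      intro x _ x' _ h1 h2
      rw [sub_pos, Real.exp_lt_exp] at h1
      rw [sub_nonpos, Real.exp_le_exp] at h2
      apply h
      nlinarith)
    (by rw [integral_sub (integrable_pu hv) (integrable_pu hu), integral_pu hν hv,
          integral_pu hν hu]; simp)
  have : ∫ x, α x * (Real.exp (v * x - cgf ν v) - Real.exp (u * x - cgf ν u)) ∂ν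
      = kmean ν α v - kmean ν α u := by
    unfold kmean
    rw [← integral_sub (integrable_mul_pu hv hα hα01) (integrable_mul_pu hu hα hα01)]
    congr 1; funext x; ring
  linarith

lemma measurable_kmean (ν : Measure ℝ) [SigmaFinite ν] {α : ℝ → ℝ} (hα : Measurable α) :
    Measurable (kmean ν α) := by
  have hc := measurable_cgf ν
  have : StronglyMeasurable
      (Function.uncurry fun u x : ℝ => α x * Real.exp (u * x - cgf ν u)) := by
    apply Measurable.stronglyMeasurable
    unfold Function.uncurry
    fun_prop
  exact (this.integral_prod_right (ν := ν)).measurable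

lemma integrable_kmean_dens {ν μ : Measure ℝ} [SigmaFinite ν]
    (hN : ∀ᵐ u ∂μ, u ∈ expDom ν) {n : ℕ} {y : ℝ} (hd : Integrable (dens ν n y) μ)
    {α : ℝ → ℝ} (hα : Measurable α) (hα01 : ∀ x, 0 ≤ α x ∧ α x ≤ 1) :
    Integrable (fun u => kmean ν α u * dens ν n y u) μ := by
  refine hd.mono' ((measurable_kmean ν hα).mul (measurable_dens ν n y)).aestronglyMeasurable ?_
  filter_upwards [hN] with u hu
  have h := kmean_mem hu hα hα01
  have := dens_pos ν n y u
  rw [Real.norm_eq_abs, abs_of_nonneg (mul_nonneg h.1 this.le)]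
  nlinarith

lemma integrable_prod_dens {ν μ : Measure ℝ} [SigmaFinite ν] [SFinite μ]
    (hN : ∀ᵐ u ∂μ, u ∈ expDom ν) {n : ℕ} {y : ℝ} (hd : Integrable (dens ν n y) μ)
    {α : ℝ → ℝ} (hα : Measurable α) (hα01 : ∀ x, 0 ≤ α x ∧ α x ≤ 1) :
    Integrable (Function.uncurry fun u x : ℝ => α x * dens ν (n + 1) (y + x) u) (μ.prod ν) := by
  have hc := measurable_cgf ν
  have hm : Measurable (Function.uncurry fun u x : ℝ => α x * dens ν (n + 1) (y + x) u) := by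
    unfold Function.uncurry dens
    fun_prop
  rw [integrable_prod_iff hm.aestronglyMeasurable]
  simp only [Function.uncurry, dens_succ]
  constructor
  · filter_upwards [hN] with u hu
    have := (integrable_mul_pu hu hα hα01).const_mul (dens ν n y u)
    refine this.congr (ae_of_all _ fun x => ?_)
    simp only; ring
  · refine (integrable_kmean_dens hN hd hα hα01).congr (ae_of_all _ fun u => ?_)
    simp only [kmean]
    rw [← integral_mul_const]
    congr 1; funext x
    rw [Real.norm_eq_abs, abs_of_nonneg
      (mul_nonneg (hα01 x).1 (mul_nonneg (dens_pos ν n y u).le (Real.exp_pos _).le))]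
    ring

lemma fubini_dens {ν μ : Measure ℝ} [SigmaFinite ν] [SFinite μ]
    (hN : ∀ᵐ u ∂μ, u ∈ expDom ν) {n : ℕ} {y : ℝ} (hd : Integrable (dens ν n y) μ)
    {α : ℝ → ℝ} (hα : Measurable α) (hα01 : ∀ x, 0 ≤ α x ∧ α x ≤ 1) :
    Integrable (fun x => α x * ∫ u, dens ν (n + 1) (y + x) u ∂μ) ν ∧
    ∫ x, α x * ∫ u, dens ν (n + 1) (y + x) u ∂μ ∂ν = ∫ u, kmean ν α u * dens ν n y u ∂μ := by
  have hi := integrable_prod_dens hN hd hα hα01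
  constructor
  · refine hi.integral_prod_right.congr (ae_of_all _ fun x => ?_)
    simp only [Function.uncurry, integral_const_mul]
  · have := integral_integral_swap hi
    simp only [integral_const_mul] at this
    rw [← this]
    congr 1; funext u
    rw [kmean, ← integral_mul_const]
    congr 1; funext x
    rw [dens_succ]; ring

/-- Mass of the unnormalised posterior above the threshold. -/
noncomputable def zp (ν μ : Measure ℝ) (θ : ℝ) (n : ℕ) (y : ℝ) : ℝ :=
  ∫ u in Ioi θ, dens ν n y u ∂μ

/-- Mass of the unnormalised posterior below the threshold. -/
noncomputable def zm (ν μ : Measure ℝ) (θ : ℝ) (n : ℕ) (y : ℝ) : ℝ :=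
  ∫ u in Iic θ, dens ν n y u ∂μ

/-- The standing assumptions in the form used by the proof. -/
structure Hyp (ν μ : Measure ℝ) (θ : ℝ) : Prop where
  hN : ∀ᵐ u ∂μ, u ∈ expDom ν
  hd : ∀ n y, Integrable (dens ν n y) μ
  hp : μ (Ioi θ) ≠ 0
  hm : μ (Iic θ) ≠ 0

/-- The class of functions in which the value functions live. -/
structure Cls (f : ℝ → ℝ) : Prop where
  conc : ConcaveOn ℝ (Icc 0 1) f
  nonneg : ∀ x ∈ Icc (0 : ℝ) 1, 0 ≤ f x
  le : ∀ x ∈ Icc (0 : ℝ) 1, f x ≤ min x (1 - x)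

lemma integral_lin {ρ : Measure ℝ} {f g h : ℝ → ℝ} (hf : Integrable f ρ) (hg : Integrable g ρ)
    (hh : Integrable h ρ) (a b c : ℝ) :
    ∫ u, a * f u + b * g u - c * h u ∂ρ
      = a * (∫ u, f u ∂ρ) + b * (∫ u, g u ∂ρ) - c * ∫ u, h u ∂ρ := by
  have h1 := integral_sub ((hf.const_mul a).add (hg.const_mul b)) (hh.const_mul c)
  have h2 := integral_add (hf.const_mul a) (hg.const_mul b)
  simp only [Pi.add_apply] at h1
  rw [h1, h2, integral_const_mul, integral_const_mul, integral_const_mul]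

section
variable {ν μ : Measure ℝ} {θ : ℝ}

lemma setInt_dens_pos (H : Hyp ν μ θ) {S : Set ℝ} (hS : μ S ≠ 0) (n : ℕ)
    (y : ℝ) : 0 < ∫ u in S, dens ν n y u ∂μ := by
  have : NeZero (μ.restrict S) := ⟨by rwa [Ne, Measure.restrict_eq_zero]⟩
  exact integral_exp_pos (H.hd n y).integrableOn

lemma zp_pos (H : Hyp ν μ θ) (n : ℕ) (y : ℝ) : 0 < zp ν μ θ n y :=
  setInt_dens_pos H H.hp n y

lemma zm_pos (H : Hyp ν μ θ) (n : ℕ) (y : ℝ) : 0 < zm ν μ θ n y :=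
  setInt_dens_pos H H.hm n y

lemma Z_eq (H : Hyp ν μ θ) (n : ℕ) (y : ℝ) :
    Z ν μ n y = zp ν μ θ n y + zm ν μ θ n y := by
  have := integral_add_compl (measurableSet_Ioi (a := θ)) (H.hd n y)
  rw [compl_Ioi] at this
  exact this.symm

lemma Z_pos (H : Hyp ν μ θ) (n : ℕ) (y : ℝ) : 0 < Z ν μ n y := by
  rw [Z_eq H]; linarith [zp_pos H n y, zm_pos H n y]

lemma q_eq (n : ℕ) (y : ℝ) :
    q ν μ θ n y = zp ν μ θ n y / Z ν μ n y := rfl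

lemma q_mul (H : Hyp ν μ θ) (n : ℕ) (y : ℝ) :
    q ν μ θ n y * Z ν μ n y = zp ν μ θ n y := by
  rw [q_eq]; field_simp [(Z_pos H n y).ne']

lemma one_sub_q_mul (H : Hyp ν μ θ) (n : ℕ) (y : ℝ) :
    (1 - q ν μ θ n y) * Z ν μ n y = zm ν μ θ n y := by
  have h1 := q_mul H n y
  have h2 := Z_eq H n y
  linarith

lemma q_mem (H : Hyp ν μ θ) (n : ℕ) (y : ℝ) : q ν μ θ n y ∈ Ioo (0 : ℝ) 1 := by
  have h1 := q_mul H n y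
  have h2 := one_sub_q_mul H n y
  have h3 := Z_pos H n y
  have h4 := zp_pos H n y
  have h5 := zm_pos H n y
  constructor
  · by_contra h; push Not at h; nlinarith
  · by_contra h; push Not at h; nlinarith

lemma q_mono (H : Hyp ν μ θ) (n : ℕ) : Monotone (q ν μ θ n) := by
  intro y y' hy
  have e : ∀ u, dens ν n y' u = Real.exp (u * (y' - y)) * dens ν n y u := by
    intro u; unfold dens; rw [← Real.exp_add]; congr 1; ring
  have h1 : Real.exp (θ * (y' - y)) * zp ν μ θ n y ≤ zp ν μ θ n y' := by
    unfold zp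
    rw [← integral_const_mul]
    refine setIntegral_mono_on ((H.hd n y).const_mul _).integrableOn (H.hd n y').integrableOn
      measurableSet_Ioi fun u hu => ?_
    rw [e u]
    refine mul_le_mul_of_nonneg_right (Real.exp_le_exp.2 ?_) (dens_pos _ _ _ _).le
    have : θ < u := hu
    nlinarith
  have h2 : zm ν μ θ n y' ≤ Real.exp (θ * (y' - y)) * zm ν μ θ n y := by
    unfold zm
    rw [← integral_const_mul]
    refine setIntegral_mono_on (H.hd n y').integrableOn ((H.hd n y).const_mul _).integrableOn
      measurableSet_Iic fun u hu => ?_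
    rw [e u]
    refine mul_le_mul_of_nonneg_right (Real.exp_le_exp.2 ?_) (dens_pos _ _ _ _).le
    have : u ≤ θ := hu
    nlinarith
  rw [q_eq, q_eq, div_le_div_iff₀ (Z_pos H _ _) (Z_pos H _ _), Z_eq H, Z_eq H]
  have a1 := zp_pos H n y
  have a2 := zm_pos H n y
  have h3 := mul_le_mul_of_nonneg_left h2 a1.le
  have h4 := mul_le_mul_of_nonneg_right h1 a2.le
  nlinarith

/-- Total mass of `kmean` integrated against the unnormalised posterior. -/
noncomputable def Jfun (ν μ : Measure ℝ) (θ : ℝ) (α β : ℝ → ℝ) (n : ℕ) (y : ℝ) : ℝ :=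
  (∫ u in Ioi θ, kmean ν α u * dens ν n y u ∂μ) + ∫ u in Iic θ, kmean ν β u * dens ν n y u ∂μ

variable [SigmaFinite ν] [IsProbabilityMeasure μ]

lemma J_mix (H : Hyp ν μ θ) {α β : ℝ → ℝ} (hα : Antitone α) (hβ : Monotone β)
    (hα01 : ∀ x, 0 ≤ α x ∧ α x ≤ 1) (hβ01 : ∀ x, 0 ≤ β x ∧ β x ≤ 1)
    (n : ℕ) {y₁ y₂ y₃ a b c : ℝ} (ha : 0 ≤ a) (hb : 0 ≤ b)
    (h1 : a * zp ν μ θ n y₁ + b * zp ν μ θ n y₃ ≤ c * zp ν μ θ n y₂)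
    (h2 : a * zm ν μ θ n y₁ + b * zm ν μ θ n y₃ ≤ c * zm ν μ θ n y₂) :
    a * Jfun ν μ θ α β n y₁ + b * Jfun ν μ θ α β n y₃ ≤ c * Jfun ν μ θ α β n y₂ := by
  set D : ℝ → ℝ := fun u => a * dens ν n y₁ u + b * dens ν n y₃ u - c * dens ν n y₂ u with hD
  set ψ : ℝ → ℝ := fun u => a * Real.exp (u * (y₁ - y₂)) + b * Real.exp (u * (y₃ - y₂)) - c
    with hψ
  have hDψ : ∀ u, D u = dens ν n y₂ u * ψ u := by
    intro u
    have e : ∀ y, dens ν n y u = dens ν n y₂ u * Real.exp (u * (y - y₂)) := by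
      intro y; unfold dens; rw [← Real.exp_add]; congr 1; ring
    simp only [hD, hψ]
    rw [e y₁, e y₃]; ring
  have hpos : ∀ u, D u ≤ 0 ↔ ψ u ≤ 0 := by
    intro u
    have := dens_pos ν n y₂ u
    rw [hDψ]
    constructor
    · intro h; by_contra h'; push Not at h'; nlinarith [mul_pos this h']
    · intro h; exact mul_nonpos_of_nonneg_of_nonpos this.le h
  have hexp : ∀ t : ℝ, ConvexOn ℝ univ fun u : ℝ => Real.exp (u * t) := by
    intro t
    have := convexOn_exp.comp_linearMap (LinearMap.mulRight ℝ t)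
    simpa [Function.comp_def] using this
  have hconv : ConvexOn ℝ univ ψ := by
    have := (((hexp (y₁ - y₂)).smul ha).add ((hexp (y₃ - y₂)).smul hb)).add_const (-c)
    simpa [hψ, sub_eq_add_neg, Pi.add_def] using this
  have hbetween : ∀ x z w, x ≤ z → z ≤ w → D x ≤ 0 → D w ≤ 0 → D z ≤ 0 := by
    intro x z w hxz hzw hx hw
    rw [hpos] at *
    have := hconv.le_max_of_mem_Icc (mem_univ x) (mem_univ w) ⟨hxz, hzw⟩
    exact this.trans (max_le hx hw)
  have hDi : Integrable D μ :=
    (((H.hd n y₁).const_mul a).add ((H.hd n y₃).const_mul b)).sub ((H.hd n y₂).const_mul c)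
  have hDint : ∀ S : Set ℝ, ∫ u in S, D u ∂μ = a * (∫ u in S, dens ν n y₁ u ∂μ)
      + b * (∫ u in S, dens ν n y₃ u ∂μ) - c * ∫ u in S, dens ν n y₂ u ∂μ := by
    intro S
    exact integral_lin (H.hd n y₁).integrableOn (H.hd n y₃).integrableOn
      (H.hd n y₂).integrableOn a b c
  have hIp : ∫ u in Ioi θ, D u ∂μ ≤ 0 := by
    rw [hDint]; change a * zp ν μ θ n y₁ + b * zp ν μ θ n y₃ - c * zp ν μ θ n y₂ ≤ 0; linarith
  have hIm : ∫ u in Iic θ, D u ∂μ ≤ 0 := by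
    rw [hDint]; change a * zm ν μ θ n y₁ + b * zm ν μ θ n y₃ - c * zm ν μ θ n y₂ ≤ 0; linarith
  have hex : ∀ S : Set ℝ, μ S ≠ 0 → ∫ u in S, D u ∂μ ≤ 0 → ∃ u ∈ S, D u ≤ 0 := by
    intro S hS hI
    obtain ⟨u, hu, h⟩ := exists_le_setAverage hS (measure_ne_top μ S) (hDi.integrableOn (s := S))
    refine ⟨u, hu, h.trans ?_⟩
    rw [setAverage_eq, smul_eq_mul]
    exact mul_nonpos_of_nonneg_of_nonpos (by positivity) hI
  obtain ⟨up, hup, hDup⟩ := hex _ H.hp hIp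
  obtain ⟨um, hum, hDum⟩ := hex _ H.hm hIm
  have hup' : θ < up := hup
  have hum' : um ≤ θ := hum
  have hNS : ∀ S : Set ℝ, MeasurableSet S → ∀ᵐ u ∂(μ.restrict S), u ∈ expDom ν ∩ S := by
    intro S hS
    filter_upwards [ae_restrict_of_ae H.hN, ae_restrict_mem hS] with u h h' using ⟨h, h'⟩
  have hkint : ∀ (γ : ℝ → ℝ), Measurable γ → (∀ x, 0 ≤ γ x ∧ γ x ≤ 1) → ∀ S : Set ℝ,
      Integrable (fun u => kmean ν γ u * D u) (μ.restrict S) ∧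
      ∫ u in S, kmean ν γ u * D u ∂μ = a * (∫ u in S, kmean ν γ u * dens ν n y₁ u ∂μ)
      + b * (∫ u in S, kmean ν γ u * dens ν n y₃ u ∂μ)
      - c * ∫ u in S, kmean ν γ u * dens ν n y₂ u ∂μ := by
    intro γ hγ hγ01 S
    have i1 := ((integrable_kmean_dens H.hN (H.hd n y₁) hγ hγ01).const_mul a).integrableOn (s := S)
    have i3 := ((integrable_kmean_dens H.hN (H.hd n y₃) hγ hγ01).const_mul b).integrableOn (s := S)
    have i2 := ((integrable_kmean_dens H.hN (H.hd n y₂) hγ hγ01).const_mul c).integrableOn (s := S)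
    have e : (fun u => kmean ν γ u * D u) = fun u => a * (kmean ν γ u * dens ν n y₁ u)
        + b * (kmean ν γ u * dens ν n y₃ u) - c * (kmean ν γ u * dens ν n y₂ u) := by
      funext u; simp only [hD]; ring
    rw [e]
    refine ⟨(i1.add i3).sub i2, ?_⟩
    exact integral_lin (integrable_kmean_dens H.hN (H.hd n y₁) hγ hγ01).integrableOn
      (integrable_kmean_dens H.hN (H.hd n y₃) hγ hγ01).integrableOn
      (integrable_kmean_dens H.hN (H.hd n y₂) hγ hγ01).integrableOn a b c
  have Kp := cross_lemma (hNS (Ioi θ) measurableSet_Ioi) hDi.integrableOn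
    (hkint α hα.measurable hα01 (Ioi θ)).1 (fun u hu => kmean_mem hu.1 hα.measurable hα01)
    (by
      intro u hu v hv hDu hDv
      refine kmean_compare hv.1 hu.1 hα.measurable hα01 fun x x' hx => hα ?_
      have huθ : θ < u := hu.2
      have : v < u := by
        by_contra h; push Not at h
        exact absurd (hbetween um u v (by linarith) h hDum hDv) (not_le.2 hDu)
      by_contra h; push Not at h
      nlinarith) hIp
  have Km := cross_lemma (hNS (Iic θ) measurableSet_Iic) hDi.integrableOn
    (hkint β hβ.measurable hβ01 (Iic θ)).1 (fun u hu => kmean_mem hu.1 hβ.measurable hβ01)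
    (by
      intro u hu v hv hDu hDv
      refine kmean_compare hv.1 hu.1 hβ.measurable hβ01 fun x x' hx => hβ ?_
      have huθ : u ≤ θ := hu.2
      have : u < v := by
        by_contra h; push Not at h
        exact absurd (hbetween v u up h (by linarith) hDv hDup) (not_le.2 hDu)
      by_contra h; push Not at h
      nlinarith) hIm
  rw [(hkint α hα.measurable hα01 (Ioi θ)).2] at Kp
  rw [(hkint β hβ.measurable hβ01 (Iic θ)).2] at Km
  unfold Jfun
  nlinarith

lemma J_integral (H : Hyp ν μ θ) {α β : ℝ → ℝ} (hα : Measurable α) (hβ : Measurable β)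
    (hα01 : ∀ x, 0 ≤ α x ∧ α x ≤ 1) (hβ01 : ∀ x, 0 ≤ β x ∧ β x ≤ 1) (n : ℕ) (y : ℝ) :
    Integrable (fun x => (α x * q ν μ θ (n + 1) (y + x) + β x * (1 - q ν μ θ (n + 1) (y + x))) *
      (Z ν μ (n + 1) (y + x) / Z ν μ n y)) ν ∧
    ∫ x, (α x * q ν μ θ (n + 1) (y + x) + β x * (1 - q ν μ θ (n + 1) (y + x))) *
      (Z ν μ (n + 1) (y + x) / Z ν μ n y) ∂ν = (Z ν μ n y)⁻¹ * Jfun ν μ θ α β n y := by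
  have e : (fun x => (α x * q ν μ θ (n + 1) (y + x) + β x * (1 - q ν μ θ (n + 1) (y + x))) *
      (Z ν μ (n + 1) (y + x) / Z ν μ n y)) = fun x => (Z ν μ n y)⁻¹ *
      (α x * zp ν μ θ (n + 1) (y + x) + β x * zm ν μ θ (n + 1) (y + x)) := by
    funext x
    rw [← q_mul H, ← one_sub_q_mul H]
    ring
  have f1 := fubini_dens (μ := μ.restrict (Ioi θ)) (ae_restrict_of_ae H.hN)
    (H.hd n y).integrableOn hα hα01
  have f2 := fubini_dens (μ := μ.restrict (Iic θ)) (ae_restrict_of_ae H.hN)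
    (H.hd n y).integrableOn hβ hβ01
  rw [e]
  refine ⟨(f1.1.add f2.1).const_mul _, ?_⟩
  rw [integral_const_mul]
  congr 1
  unfold Jfun
  rw [← f1.2, ← f2.2]
  exact integral_add f1.1 f2.1

/-- Supporting lines along the level at `y`. -/
lemma exists_lines (H : Hyp ν μ θ) {f : ℝ → ℝ} (hf : Cls f) (n : ℕ) (y : ℝ) :
    ∃ α β : ℝ → ℝ, Antitone α ∧ Monotone β ∧ (∀ x, 0 ≤ α x ∧ α x ≤ 1) ∧
      (∀ x, 0 ≤ β x ∧ β x ≤ 1) ∧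
      (∀ x, f (q ν μ θ n (y + x)) =
        α x * q ν μ θ n (y + x) + β x * (1 - q ν μ θ n (y + x))) ∧
      ∀ x, ∀ p ∈ Icc (0 : ℝ) 1, f p ≤ α x * p + β x * (1 - p) := by
  have h := support_line hf.conc hf.nonneg hf.le
  choose! A B a0 a1 b0 b1 heq hle using h
  have m := fun x => q_mem H n (y + x)
  have key : ∀ r ∈ Ioo (0 : ℝ) 1, ∀ r' ∈ Ioo (0 : ℝ) 1, r ≤ r' → A r' ≤ A r ∧ B r ≤ B r' := by
    intro r m1 r' m2 hx
    rcases hx.eq_or_lt with hq | hq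
    · subst hq; simp
    · have e1 := hle r' m2 r (Ioo_subset_Icc_self m1)
      have e2 := hle r m1 r' (Ioo_subset_Icc_self m2)
      rw [heq r m1] at e1
      rw [heq r' m2] at e2
      obtain ⟨p1, p2⟩ := m1
      obtain ⟨p3, p4⟩ := m2
      have g1 : 0 ≤ (A r - A r') * (r' - r) := by
        have := mul_le_mul_of_nonneg_right e1 (sub_pos.2 p4).le
        have := mul_le_mul_of_nonneg_right e2 (sub_pos.2 p2).le
        linarith
      have g2 : 0 ≤ (B r' - B r) * (r' - r) := by
        have := mul_le_mul_of_nonneg_right e1 p3.le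
        have := mul_le_mul_of_nonneg_right e2 p1.le
        linarith
      have hd := sub_pos.2 hq
      exact ⟨sub_nonneg.1 (nonneg_of_mul_nonneg_left g1 hd),
        sub_nonneg.1 (nonneg_of_mul_nonneg_left g2 hd)⟩
  have hqm : ∀ {x x' : ℝ}, x ≤ x' → q ν μ θ n (y + x) ≤ q ν μ θ n (y + x') :=
    fun h => q_mono H n (by linarith)
  exact ⟨fun x => A (q ν μ θ n (y + x)), fun x => B (q ν μ θ n (y + x)),
    fun x x' h => (key _ (m x) _ (m x') (hqm h)).1,
    fun x x' h => (key _ (m x) _ (m x') (hqm h)).2,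
    fun x => ⟨a0 _ (m x), a1 _ (m x)⟩, fun x => ⟨b0 _ (m x), b1 _ (m x)⟩,
    fun x => heq _ (m x), fun x => hle _ (m x)⟩

lemma T_integrable (H : Hyp ν μ θ) {f : ℝ → ℝ} (hf : Cls f) (n : ℕ) (y : ℝ) :
    Integrable (fun x => f (q ν μ θ (n + 1) (y + x)) *
      (Z ν μ (n + 1) (y + x) / Z ν μ n y)) ν := by
  obtain ⟨α, β, hα, hβ, hα01, hβ01, heq, -⟩ := exists_lines H hf (n + 1) y
  simp only [heq]
  exact (J_integral H hα.measurable hβ.measurable hα01 hβ01 n y).1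

lemma T_nonneg (H : Hyp ν μ θ) {f : ℝ → ℝ} (hf : ∀ x ∈ Icc (0 : ℝ) 1, 0 ≤ f x)
    (Y : ℕ → ℝ → ℝ) (n : ℕ) (p : ℝ) : 0 ≤ T ν μ θ Y n f p :=
  integral_nonneg fun x => mul_nonneg (hf _ (Ioo_subset_Icc_self (q_mem H _ _)))
    (div_nonneg (Z_pos H _ _).le (Z_pos H _ _).le)

lemma T_mono (H : Hyp ν μ θ) {f g : ℝ → ℝ} (hf : Cls f) (hg : Cls g)
    (h : ∀ x ∈ Ioo (0 : ℝ) 1, f x ≤ g x)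
    (Y : ℕ → ℝ → ℝ) (n : ℕ) (p : ℝ) : T ν μ θ Y n f p ≤ T ν μ θ Y n g p :=
  integral_mono (T_integrable H hf n _) (T_integrable H hg n _) fun x =>
    mul_le_mul_of_nonneg_right (h _ (q_mem H _ _))
      (div_nonneg (Z_pos H _ _).le (Z_pos H _ _).le)

lemma T_super (H : Hyp ν μ θ) {Y : ℕ → ℝ → ℝ}
    (hY : ∀ (n : ℕ), ∀ p ∈ Ioo (0 : ℝ) 1, q ν μ θ n (Y n p) = p)
    {f : ℝ → ℝ} (hf : Cls f) (n : ℕ) {p₁ p₂ p₃ a b : ℝ}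
    (m₁ : p₁ ∈ Ioo (0 : ℝ) 1) (m₂ : p₂ ∈ Ioo (0 : ℝ) 1) (m₃ : p₃ ∈ Ioo (0 : ℝ) 1)
    (ha : 0 ≤ a) (hb : 0 ≤ b) (h1 : a * p₁ + b * p₃ ≤ p₂)
    (h2 : a * (1 - p₁) + b * (1 - p₃) ≤ 1 - p₂) :
    a * T ν μ θ Y n f p₁ + b * T ν μ θ Y n f p₃ ≤ T ν μ θ Y n f p₂ := by
  obtain ⟨α, β, hα, hβ, hα01, hβ01, heq, hle⟩ := exists_lines H hf (n + 1) (Y n p₂)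
  have hJ := J_integral H hα.measurable hβ.measurable hα01 hβ01 n
  have hT2 : T ν μ θ Y n f p₂ = (Z ν μ n (Y n p₂))⁻¹ * Jfun ν μ θ α β n (Y n p₂) := by
    rw [← (hJ _).2]
    unfold T
    simp only [heq]
  have hT : ∀ p, T ν μ θ Y n f p ≤ (Z ν μ n (Y n p))⁻¹ * Jfun ν μ θ α β n (Y n p) := by
    intro p
    rw [← (hJ _).2]
    exact integral_mono (T_integrable H hf n _) (hJ _).1 fun x =>
      mul_le_mul_of_nonneg_right (hle x _ (Ioo_subset_Icc_self (q_mem H _ _)))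
        (div_nonneg (Z_pos H _ _).le (Z_pos H _ _).le)
  have hzp : ∀ p ∈ Ioo (0 : ℝ) 1, (Z ν μ n (Y n p))⁻¹ * zp ν μ θ n (Y n p) = p := by
    intro p hp
    conv_rhs => rw [← hY n p hp]
    rw [q_eq, div_eq_inv_mul]
  have hzm : ∀ p ∈ Ioo (0 : ℝ) 1, (Z ν μ n (Y n p))⁻¹ * zm ν μ θ n (Y n p) = 1 - p := by
    intro p hp
    rw [← one_sub_q_mul H, hY n p hp]
    field_simp [(Z_pos H n (Y n p)).ne']
  have hZ := fun p => inv_nonneg.2 (Z_pos H n (Y n p)).le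
  have key := J_mix H hα hβ hα01 hβ01 n (y₁ := Y n p₁) (y₂ := Y n p₂) (y₃ := Y n p₃)
    (a := a * (Z ν μ n (Y n p₁))⁻¹) (b := b * (Z ν μ n (Y n p₃))⁻¹) (c := (Z ν μ n (Y n p₂))⁻¹)
    (mul_nonneg ha (hZ _)) (mul_nonneg hb (hZ _))
    (by rw [mul_assoc, mul_assoc, hzp _ m₁, hzp _ m₂, hzp _ m₃]; exact h1)
    (by rw [mul_assoc, mul_assoc, hzm _ m₁, hzm _ m₂, hzm _ m₃]; exact h2)
  rw [mul_assoc, mul_assoc, ← hT2] at key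
  linarith [mul_le_mul_of_nonneg_left (hT p₁) ha, mul_le_mul_of_nonneg_left (hT p₃) hb]

lemma concave_tent : ConcaveOn ℝ (Icc (0 : ℝ) 1) fun x => min x (1 - x) := by
  have h1 : ConcaveOn ℝ (Icc (0 : ℝ) 1) fun x : ℝ => x := concaveOn_id (convex_Icc _ _)
  have h2 : ConcaveOn ℝ (Icc (0 : ℝ) 1) fun x : ℝ => 1 - x :=
    (concaveOn_const 1 (convex_Icc _ _)).sub (convexOn_id (convex_Icc _ _))
  exact h1.inf h2

lemma W_cls (H : Hyp ν μ θ) {Y : ℕ → ℝ → ℝ} {c : ℝ} (hc : 0 < c)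
    (hY : ∀ (n : ℕ), ∀ p ∈ Ioo (0 : ℝ) 1, q ν μ θ n (Y n p) = p) (k : ℕ) :
    ∀ n, Cls (W ν μ θ Y c k n) := by
  have tent0 : ∀ x ∈ Icc (0 : ℝ) 1, 0 ≤ min x (1 - x) :=
    fun x hx => le_min hx.1 (sub_nonneg.2 hx.2)
  induction k with
  | zero => exact fun n => ⟨concave_tent, tent0, fun x _ => le_rfl⟩
  | succ k ih =>
    intro n
    have hT0 := fun p => T_nonneg H (ih (n + 1)).nonneg Y n p
    have hWle : ∀ x, W ν μ θ Y c (k + 1) n x ≤ min x (1 - x) := fun x => min_le_left _ _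
    have hW0 : ∀ x ∈ Icc (0 : ℝ) 1, 0 ≤ W ν μ θ Y c (k + 1) n x := fun x hx =>
      le_min (tent0 x hx) (by linarith [hT0 x])
    refine ⟨⟨convex_Icc _ _, ?_⟩, hW0, fun x _ => hWle x⟩
    intro x hx y hy a b ha hb hab
    have htent := concave_tent.2 hx hy ha hb hab
    simp only [smul_eq_mul] at htent ⊢
    have hup : a * W ν μ θ Y c (k + 1) n x + b * W ν μ θ Y c (k + 1) n y ≤
        min (a * x + b * y) (1 - (a * x + b * y)) := by
      refine le_trans ?_ htent
      exact add_le_add (mul_le_mul_of_nonneg_left (hWle x) ha)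
        (mul_le_mul_of_nonneg_left (hWle y) hb)
    have hmem : a * x + b * y ∈ Icc (0 : ℝ) 1 := by
      have := (convex_Icc (0 : ℝ) 1) hx hy ha hb hab
      simpa using this
    have hend : ∀ z ∈ Icc (0 : ℝ) 1, ∃ z' ∈ Ioo (0 : ℝ) 1, ∃ t : ℝ, 0 ≤ t ∧ t ≤ 1 ∧
        t * z' ≤ z ∧ t * (1 - z') ≤ 1 - z ∧
        W ν μ θ Y c (k + 1) n z ≤ t * (c + T ν μ θ Y n (W ν μ θ Y c k (n + 1)) z') := by
      intro z hz
      by_cases hz' : z ∈ Ioo (0 : ℝ) 1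
      · exact ⟨z, hz', 1, zero_le_one, le_rfl, by simp, by simp, by
          rw [one_mul]; exact min_le_right _ _⟩
      · refine ⟨1 / 2, by norm_num, 0, le_rfl, zero_le_one, by simpa using hz.1,
          by simpa using hz.2, ?_⟩
        rw [zero_mul]
        refine (hWle z).trans ?_
        by_contra h
        push Not at h
        rw [lt_min_iff] at h
        exact hz' ⟨h.1, by linarith [h.2]⟩
    by_cases hin : a * x + b * y ∈ Ioo (0 : ℝ) 1
    · refine le_min hup ?_
      obtain ⟨x', mx, s, s0, s1, sx1, sx2, hWx⟩ := hend x hx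
      obtain ⟨y', my, t, t0, t1, ty1, ty2, hWy⟩ := hend y hy
      have key := T_super H hY (ih (n + 1)) n (a := a * s) (b := b * t) mx hin my
        (mul_nonneg ha s0) (mul_nonneg hb t0)
        (by nlinarith [mul_le_mul_of_nonneg_left sx1 ha, mul_le_mul_of_nonneg_left ty1 hb])
        (by nlinarith [mul_le_mul_of_nonneg_left sx2 ha, mul_le_mul_of_nonneg_left ty2 hb])
      have e1 := mul_le_mul_of_nonneg_left hWx ha
      have e2 := mul_le_mul_of_nonneg_left hWy hb
      have e3 : (a * s + b * t) * c ≤ 1 * c := by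
        refine mul_le_mul_of_nonneg_right ?_ hc.le
        nlinarith
      linarith
    · refine le_trans hup (le_trans ?_ (hW0 _ hmem))
      by_contra h
      push Not at h
      rw [lt_min_iff] at h
      exact hin ⟨h.1, by linarith [h.2]⟩

end

/-- If for all `m ≤ n` and all concave `f : [0,1] → [0,∞)` one has
`(T_m f)(p) ≤ (T_n f)(p)` (convex-order domination of the one-step
transitions), then the value function `V(n,p)` is nondecreasing in `n`. -/
theorem value_monotone_of_convex_order (ν μ : Measure ℝ) [SigmaFinite ν]
    [IsProbabilityMeasure μ] (θ₀ : ℝ) (Y : ℕ → ℝ → ℝ) (c : ℝ) (hc : 0 < c)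
    (hsupp : msupport μ ⊆ interior (expDom ν))
    (h0 : 0 < μ (Set.Ioi θ₀)) (h1 : μ (Set.Ioi θ₀) < 1)
    (hint : ∀ (n : ℕ) (y : ℝ),
      Integrable (fun u => (1 + |u|) * Real.exp (u * y - (n : ℝ) * cgf ν u)) μ)
    (hY : ∀ (n : ℕ), ∀ p ∈ Set.Ioo (0 : ℝ) 1, q ν μ θ₀ n (Y n p) = p)
    (hdom : ∀ p ∈ Set.Ioo (0 : ℝ) 1, ∀ m n : ℕ, m ≤ n →
      ∀ f : ℝ → ℝ, ConcaveOn ℝ (Set.Icc 0 1) f →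
        (∀ x ∈ Set.Icc (0 : ℝ) 1, 0 ≤ f x) →
        T ν μ θ₀ Y m f p ≤ T ν μ θ₀ Y n f p) :
    ∀ m n : ℕ, m ≤ n → ∀ p ∈ Set.Ioo (0 : ℝ) 1,
      Vfun ν μ θ₀ Y c m p ≤ Vfun ν μ θ₀ Y c n p := by
  have H : Hyp ν μ θ₀ := by
    refine ⟨ae_expDom ν μ hsupp, integrable_dens hint, h0.ne', ?_⟩
    intro h
    have h3 : μ (Set.Ioi θ₀)ᶜ = 0 := by rwa [compl_Ioi]
    rw [prob_compl_eq_zero_iff measurableSet_Ioi] at h3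
    exact h1.ne h3
  have hcls := W_cls H hc hY
  have hmono : ∀ k : ℕ, ∀ m n : ℕ, m ≤ n → ∀ p ∈ Set.Ioo (0 : ℝ) 1,
      W ν μ θ₀ Y c k m p ≤ W ν μ θ₀ Y c k n p := by
    intro k
    induction k with
    | zero => intro m n _ p _; exact le_rfl
    | succ k ih =>
      intro m n hmn p hp
      refine min_le_min le_rfl (add_le_add le_rfl ?_)
      refine le_trans (hdom p hp m n hmn _ (hcls k (m + 1)).conc (hcls k (m + 1)).nonneg) ?_
      exact T_mono H (hcls k (m + 1)) (hcls k (n + 1))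
        (fun x hx => ih (m + 1) (n + 1) (by omega) x hx) Y n p
  intro m n hmn p hp
  refine ciInf_mono ⟨0, ?_⟩ fun k => hmono k m n hmn p hp
  rintro _ ⟨k, rfl⟩
  exact (hcls k m).nonneg p (Ioo_subset_Icc_self hp)
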